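/- Let N be a submultiplicative, unitarily invariant norm on the n×n complex matrices and let α₁, α₂ ∈ [0, π/2). If X ∈ M^s_{n,α₁} and Y ∈ M^s_{n,α₂}, then ω_N(XY) ≤ sec(α₁)·sec(α₂)·ω_N(X)·ω_N(Y). -/

import Mathlib

open scoped ComplexOrder Matrix

/-- The Hermitian (real) part of a matrix: `Re(X) = (X + X*)/2`. -/
noncomputable def matRe {n : ℕ} (X : Matrix (Fin n) (Fin n) ℂ) :
    Matrix (Fin n) (Fin n) ℂ :=
  (1 / 2 : ℂ) • (X + Xᴴ)

/-- The skew (imaginary) part of a matrix: `Im(X) = (X - X*)/(2i)`. -/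
noncomputable def matIm {n : ℕ} (X : Matrix (Fin n) (Fin n) ℂ) :
    Matrix (Fin n) (Fin n) ℂ :=
  (1 / (2 * Complex.I)) • (X - Xᴴ)

/-- The generalized numerical radius induced by a norm `N`:
`ω_N(X) = sup_θ N(Re(e^{iθ} X))`. -/
noncomputable def gnr {n : ℕ} (N : Matrix (Fin n) (Fin n) ℂ → ℝ)
    (X : Matrix (Fin n) (Fin n) ℂ) : ℝ :=
  ⨆ θ : ℝ, N (matRe (Complex.exp (θ * Complex.I) • X))

/-- The numerical range `W(X) = {⟨Xx, x⟩ : ‖x‖ = 1}` (standard inner product on ℂⁿ). -/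
def numRange {n : ℕ} (X : Matrix (Fin n) (Fin n) ℂ) : Set ℂ :=
  { z | ∃ x : Fin n → ℂ, star x ⬝ᵥ x = 1 ∧ z = star x ⬝ᵥ X.mulVec x }

/-- The sector `S_α = {z : Re z > 0, |Im z| ≤ tan(α) Re z}`. -/
def sector (α : ℝ) : Set ℂ :=
  { z | 0 < z.re ∧ |z.im| ≤ Real.tan α * z.re }

/-- The class `M^s_{n,α}` of matrices `X` such that `W(zX) ⊆ S_α` for some unimodular `z`. -/
def sectClass (n : ℕ) (α : ℝ) : Set (Matrix (Fin n) (Fin n) ℂ) :=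
  { X | ∃ z : ℂ, ‖z‖ = 1 ∧ numRange (z • X) ⊆ sector α }

section Helpers
open scoped MatrixOrder Matrix.Norms.L2Operator

theorem aux_sqrt {n : ℕ} {P : Matrix (Fin n) (Fin n) ℂ} (hP : P.PosDef) :
    ∃ R : Matrix (Fin n) (Fin n) ℂ, R.PosDef ∧ R * R = P := by
  have h0 : 0 ≤ P := hP.posSemidef.nonneg
  have hR : CFC.sqrt P * CFC.sqrt P = P := CFC.sqrt_mul_sqrt_self P h0
  refine ⟨CFC.sqrt P, ?_, hR⟩
  have h1 : (CFC.sqrt P).PosSemidef := Matrix.nonneg_iff_posSemidef.1 (CFC.sqrt_nonneg P)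
  rw [h1.posDef_iff_isUnit]
  have h2 := hP.isUnit
  rw [← hR] at h2
  rw [Matrix.isUnit_iff_isUnit_det] at h2 ⊢
  rw [Matrix.det_mul] at h2
  exact isUnit_of_mul_isUnit_left h2

theorem aux_polar {n : ℕ} {X : Matrix (Fin n) (Fin n) ℂ} (hX : IsUnit X) :
    ∃ V P : Matrix (Fin n) (Fin n) ℂ, V ∈ Matrix.unitaryGroup (Fin n) ℂ ∧ P.PosDef ∧
      X = V * P ∧ P * P = Xᴴ * X := by
  have h1 : (Xᴴ * X).PosDef := by
    apply Matrix.PosDef.conjTranspose_mul_self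
    exact Matrix.mulVec_injective_of_isUnit hX
  obtain ⟨P, hP, hPP⟩ := aux_sqrt h1
  have hd : IsUnit P.det := (Matrix.isUnit_iff_isUnit_det _).1 hP.isUnit
  refine ⟨X * P⁻¹, P, ?_, hP, ?_, hPP⟩
  · rw [Matrix.mem_unitaryGroup_iff', Matrix.star_eq_conjTranspose, Matrix.conjTranspose_mul,
      hP.inv.isHermitian.eq]
    calc P⁻¹ * Xᴴ * (X * P⁻¹) = P⁻¹ * (Xᴴ * X) * P⁻¹ := by noncomm_ring
      _ = (P⁻¹ * P) * (P * P⁻¹) := by rw [← hPP]; noncomm_ring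
      _ = 1 := by rw [Matrix.nonsing_inv_mul _ hd, Matrix.mul_nonsing_inv _ hd, one_mul]
  · rw [mul_assoc, Matrix.nonsing_inv_mul _ hd, mul_one]

theorem aux_mean {n : ℕ} {H : Matrix (Fin n) (Fin n) ℂ} (hH : H.PosDef)
    (hle : (1 - H * H).PosSemidef) :
    ∃ W : Matrix (Fin n) (Fin n) ℂ, W ∈ Matrix.unitaryGroup (Fin n) ℂ ∧
      star W ∈ Matrix.unitaryGroup (Fin n) ℂ ∧ H = (1 / 2 : ℂ) • (W + star W) := by
  have hsa : IsSelfAdjoint H := hH.isHermitian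
  have h2 : H * H ≤ 1 := hle
  have hn : ‖H‖ ≤ 1 := by
    have h0 : 0 ≤ H * H := by
      have := (Matrix.posSemidef_conjTranspose_mul_self H).nonneg
      rwa [hH.isHermitian.eq] at this
    have := (CStarAlgebra.norm_le_one_iff_of_nonneg (H * H) h0).2 h2
    rw [hsa.norm_mul_self] at this
    exact (sq_le_one_iff₀ (norm_nonneg _)).1 this
  have hu := hsa.self_add_I_smul_cfcSqrt_sub_sq_mem_unitary H hn
  refine ⟨_, hu, Unitary.star_mem hu, ?_⟩
  have h3 : star (CFC.sqrt (1 - H ^ 2)) = CFC.sqrt (1 - H ^ 2) :=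
    (CFC.sqrt_nonneg (1 - H ^ 2)).isSelfAdjoint
  rw [star_add, star_smul, h3, hsa.star_eq]
  have : star Complex.I = -Complex.I := Complex.conj_I
  rw [this]
  module

theorem aux_UL {n : ℕ} (N : Matrix (Fin n) (Fin n) ℂ → ℝ)
    (hUI : ∀ U V A : Matrix (Fin n) (Fin n) ℂ, U ∈ Matrix.unitaryGroup (Fin n) ℂ →
      V ∈ Matrix.unitaryGroup (Fin n) ℂ → N (U * A * V) = N A)
    {U : Matrix (Fin n) (Fin n) ℂ} (hU : U ∈ Matrix.unitaryGroup (Fin n) ℂ)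
    (A : Matrix (Fin n) (Fin n) ℂ) : N (U * A) = N A := by
  simpa using hUI U 1 A hU (one_mem _)

theorem aux_UR {n : ℕ} (N : Matrix (Fin n) (Fin n) ℂ → ℝ)
    (hUI : ∀ U V A : Matrix (Fin n) (Fin n) ℂ, U ∈ Matrix.unitaryGroup (Fin n) ℂ →
      V ∈ Matrix.unitaryGroup (Fin n) ℂ → N (U * A * V) = N A)
    {U : Matrix (Fin n) (Fin n) ℂ} (hU : U ∈ Matrix.unitaryGroup (Fin n) ℂ)
    (A : Matrix (Fin n) (Fin n) ℂ) : N (A * U) = N A := by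
  simpa using hUI 1 U A (one_mem _) hU

theorem aux_star {n : ℕ} (N : Matrix (Fin n) (Fin n) ℂ → ℝ)
    (hUI : ∀ U V A : Matrix (Fin n) (Fin n) ℂ, U ∈ Matrix.unitaryGroup (Fin n) ℂ →
      V ∈ Matrix.unitaryGroup (Fin n) ℂ → N (U * A * V) = N A)
    {X : Matrix (Fin n) (Fin n) ℂ} (hX : IsUnit X) : N Xᴴ = N X := by
  obtain ⟨V, P, hV, hP, rfl, -⟩ := aux_polar hX
  rw [aux_UL N hUI hV, Matrix.conjTranspose_mul, hP.isHermitian.eq]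
  exact aux_UR N hUI (Unitary.star_mem hV) P

theorem aux_contr {n : ℕ} (N : Matrix (Fin n) (Fin n) ℂ → ℝ)
    (hNs : ∀ (c : ℂ) (A : Matrix (Fin n) (Fin n) ℂ), N (c • A) = ‖c‖ * N A)
    (hNa : ∀ A B : Matrix (Fin n) (Fin n) ℂ, N (A + B) ≤ N A + N B)
    (hUI : ∀ U V A : Matrix (Fin n) (Fin n) ℂ, U ∈ Matrix.unitaryGroup (Fin n) ℂ →
      V ∈ Matrix.unitaryGroup (Fin n) ℂ → N (U * A * V) = N A)
    {K : Matrix (Fin n) (Fin n) ℂ} (hK : IsUnit K)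
    (hle : (1 - Kᴴ * K).PosSemidef) (B : Matrix (Fin n) (Fin n) ℂ) :
    N (K * B * Kᴴ) ≤ N B := by
  obtain ⟨V, P, hV, hP, hVP, hPP⟩ := aux_polar hK
  rw [← hPP] at hle
  obtain ⟨W, hW, hW', hPW⟩ := aux_mean hP hle
  have h2 : ‖(1 / 2 : ℂ)‖ = 1 / 2 := by norm_num
  have hl : ∀ C, N (P * C) ≤ N C := by
    intro C
    rw [hPW, smul_mul_assoc, hNs, add_mul, h2]
    have := hNa (W * C) (star W * C)
    rw [aux_UL N hUI hW, aux_UL N hUI hW'] at this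
    linarith
  have hr : ∀ C, N (C * P) ≤ N C := by
    intro C
    rw [hPW, mul_smul_comm, hNs, mul_add, h2]
    have := hNa (C * W) (C * star W)
    rw [aux_UR N hUI hW, aux_UR N hUI hW'] at this
    linarith
  have : K * B * Kᴴ = V * (P * B * P) * star V := by
    rw [hVP, Matrix.conjTranspose_mul, hP.isHermitian.eq, Matrix.star_eq_conjTranspose]
    noncomm_ring
  rw [this, hUI _ _ _ hV (Unitary.star_mem hV)]
  exact (hr _).trans (hl _)

theorem aux_mono {n : ℕ} (N : Matrix (Fin n) (Fin n) ℂ → ℝ)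
    (hNs : ∀ (c : ℂ) (A : Matrix (Fin n) (Fin n) ℂ), N (c • A) = ‖c‖ * N A)
    (hNa : ∀ A B : Matrix (Fin n) (Fin n) ℂ, N (A + B) ≤ N A + N B)
    (hUI : ∀ U V A : Matrix (Fin n) (Fin n) ℂ, U ∈ Matrix.unitaryGroup (Fin n) ℂ →
      V ∈ Matrix.unitaryGroup (Fin n) ℂ → N (U * A * V) = N A)
    {P Q : Matrix (Fin n) (Fin n) ℂ} (hP : P.PosDef) (hQ : Q.PosDef)
    (hle : (Q - P).PosSemidef) : N P ≤ N Q := by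
  obtain ⟨S, hS, hSS⟩ := aux_sqrt hP
  obtain ⟨R, hR, hRR⟩ := aux_sqrt hQ
  have hd : IsUnit R.det := (Matrix.isUnit_iff_isUnit_det _).1 hR.isUnit
  have e1 : R⁻¹ * R = 1 := Matrix.nonsing_inv_mul _ hd
  have e2 : R * R⁻¹ = 1 := Matrix.mul_nonsing_inv _ hd
  have hKs : (S * R⁻¹)ᴴ = R⁻¹ * S := by
    rw [Matrix.conjTranspose_mul, hS.isHermitian.eq, hR.inv.isHermitian.eq]
  have hK : IsUnit (S * R⁻¹) := hS.isUnit.mul hR.inv.isUnit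
  have h := aux_contr N hNs hNa hUI hK ?_ Q
  · rw [hKs] at h
    have : S * R⁻¹ * Q * (R⁻¹ * S) = P := by
      calc S * R⁻¹ * Q * (R⁻¹ * S) = S * (R⁻¹ * R) * (R * R⁻¹) * S := by
            rw [← hRR]; noncomm_ring
        _ = P := by rw [e1, e2, mul_one, mul_one, hSS]
    rwa [this] at h
  · have h3 := hle.conjTranspose_mul_mul_same R⁻¹
    rw [hR.inv.isHermitian.eq] at h3
    convert h3 using 1
    rw [hKs]
    calc 1 - R⁻¹ * S * (S * R⁻¹) = (R⁻¹ * R) * (R * R⁻¹) - R⁻¹ * (S * S) * R⁻¹ := by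
          rw [e1, e2, mul_one]; noncomm_ring
      _ = R⁻¹ * (R * R - S * S) * R⁻¹ := by noncomm_ring
      _ = _ := by rw [hRR, hSS]

theorem aux_sq {n : ℕ} {A B : Matrix (Fin n) (Fin n) ℂ} (hA : A.PosDef)
    {t : ℝ} (ht : 0 ≤ t) (h1 : ((t : ℂ) • A + B).PosSemidef)
    (h2 : ((t : ℂ) • A - B).PosSemidef) :
    (((t : ℂ) ^ 2) • A - B * A⁻¹ * B).PosSemidef := by
  have hd : IsUnit A.det := (Matrix.isUnit_iff_isUnit_det _).1 hA.isUnit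
  have e1 : A⁻¹ * A = 1 := Matrix.nonsing_inv_mul _ hd
  have e2 : A * A⁻¹ = 1 := Matrix.mul_nonsing_inv _ hd
  have e3 : ∀ C, A * (A⁻¹ * C) = C := fun C => by rw [← mul_assoc, e2, one_mul]
  have e4 : ∀ C, A⁻¹ * (A * C) = C := fun C => by rw [← mul_assoc, e1, one_mul]
  rcases ht.eq_or_lt with rfl | ht
  · have hB : B = 0 := by
      apply le_antisymm
      · rw [Matrix.le_iff]; simpa using h2
      · rw [Matrix.le_iff]; simpa using h1
    subst hB
    simpa using Matrix.PosSemidef.zero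
  · have k1 := h1.conjTranspose_mul_mul_same (A⁻¹ * ((t : ℂ) • A - B))
    have k2 := h2.conjTranspose_mul_mul_same (A⁻¹ * ((t : ℂ) • A + B))
    rw [Matrix.conjTranspose_mul, hA.inv.isHermitian.eq, h2.isHermitian.eq] at k1
    rw [Matrix.conjTranspose_mul, hA.inv.isHermitian.eq, h1.isHermitian.eq] at k2
    have hc : (0 : ℂ) ≤ ((1 / (2 * t) : ℝ) : ℂ) := by
      rw [Complex.zero_le_real]; positivity
    have k3 := (k1.add k2).smul hc
    convert k3 using 1
    have key : ((t : ℂ) • A - B) * A⁻¹ * ((t : ℂ) • A + B) * (A⁻¹ * ((t : ℂ) • A - B)) +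
      ((t : ℂ) • A + B) * A⁻¹ * ((t : ℂ) • A - B) * (A⁻¹ * ((t : ℂ) • A + B))
      = (2 * t : ℂ) • (((t : ℂ) ^ 2) • A - B * A⁻¹ * B) := by
      simp only [mul_add, add_mul, mul_sub, sub_mul, smul_mul_assoc, mul_smul_comm, mul_assoc,
        e1, e2, e3, e4, mul_one, one_mul]
      module
    rw [key, smul_smul]
    have : ((1 / (2 * t) : ℝ) : ℂ) * (2 * t : ℂ) = 1 := by
      have : (t : ℂ) ≠ 0 := by exact_mod_cast ht.ne'
      push_cast; field_simp
    rw [this, one_smul]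

theorem aux_dom {n : ℕ} {A B V : Matrix (Fin n) (Fin n) ℂ} (hA : A.PosDef) (hB : B.IsHermitian)
    {t s : ℝ} (hs : 0 < s) (hst : s ^ 2 = 1 + t ^ 2)
    (h : (((t : ℂ) ^ 2) • A - B * A⁻¹ * B).PosSemidef) :
    ((s : ℂ) • (A + Vᴴ * A * V) - ((A + Complex.I • B)ᴴ * V + Vᴴ * (A + Complex.I • B))).PosSemidef := by
  have hd : IsUnit A.det := (Matrix.isUnit_iff_isUnit_det _).1 hA.isUnit
  have e1 : A⁻¹ * A = 1 := Matrix.nonsing_inv_mul _ hd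
  have e2 : A * A⁻¹ = 1 := Matrix.mul_nonsing_inv _ hd
  have e3 : ∀ C, A * (A⁻¹ * C) = C := fun C => by rw [← mul_assoc, e2, one_mul]
  have e4 : ∀ C, A⁻¹ * (A * C) = C := fun C => by rw [← mul_assoc, e1, one_mul]
  have hc : (0 : ℂ) ≤ ((1 / s : ℝ) : ℂ) := by
    rw [Complex.zero_le_real]; positivity
  have k1 := (hA.inv.posSemidef.conjTranspose_mul_mul_same
    ((A + Complex.I • B) - (s : ℂ) • (A * V)))
  have k3 := (k1.add h).smul hc
  have hI : star Complex.I = -Complex.I := Complex.conj_I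
  have hS : star (s : ℂ) = s := Complex.conj_ofReal s
  have hI2 : Complex.I * Complex.I = -1 := Complex.I_mul_I
  have hs0 : (s : ℂ) ≠ 0 := by exact_mod_cast hs.ne'
  have hst' : (t : ℂ) ^ 2 = (s : ℂ) ^ 2 - 1 := by
    have : (s : ℂ) ^ 2 = 1 + (t : ℂ) ^ 2 := by exact_mod_cast hst
    rw [this]; ring
  have e : ((1 / s : ℝ) : ℂ) = (s : ℂ)⁻¹ := by push_cast; ring
  refine (congrArg Matrix.PosSemidef ?_).mp k3
  symm
  rw [hst', e, eq_inv_smul_iff₀ hs0]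
  simp only [Matrix.conjTranspose_add, Matrix.conjTranspose_sub, Matrix.conjTranspose_smul,
    Matrix.conjTranspose_mul, hA.isHermitian.eq, hB.eq, hI, hS]
  simp only [mul_add, add_mul, mul_sub, sub_mul, smul_mul_assoc, mul_smul_comm, mul_assoc,
        e1, e2, e3, e4, mul_one, one_mul]
  match_scalars <;> (try ring_nf) <;> simp

theorem aux_sec {n : ℕ} (N : Matrix (Fin n) (Fin n) ℂ → ℝ)
    (hNs : ∀ (c : ℂ) (A : Matrix (Fin n) (Fin n) ℂ), N (c • A) = ‖c‖ * N A)
    (hNa : ∀ A B : Matrix (Fin n) (Fin n) ℂ, N (A + B) ≤ N A + N B)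
    (hUI : ∀ U V A : Matrix (Fin n) (Fin n) ℂ, U ∈ Matrix.unitaryGroup (Fin n) ℂ →
      V ∈ Matrix.unitaryGroup (Fin n) ℂ → N (U * A * V) = N A)
    {A B : Matrix (Fin n) (Fin n) ℂ} (hA : A.PosDef) (hB : B.IsHermitian)
    {t s : ℝ} (ht : 0 ≤ t) (hs : 0 < s) (hst : s ^ 2 = 1 + t ^ 2)
    (h1 : ((t : ℂ) • A + B).PosSemidef) (h2 : ((t : ℂ) • A - B).PosSemidef)
    (hu : IsUnit (A + Complex.I • B)) : N (A + Complex.I • B) ≤ s * N A := by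
  obtain ⟨V, P, hV, hP, hVP, -⟩ := aux_polar hu
  have hVV : Vᴴ * V = 1 := Matrix.mem_unitaryGroup_iff'.1 hV
  have hd := aux_dom (V := V) hA hB hs hst (aux_sq hA ht h1 h2)
  rw [hVP] at hd ⊢
  rw [aux_UL N hUI hV]
  have hc : (0 : ℂ) ≤ ((1 / 2 : ℝ) : ℂ) := by
    rw [Complex.zero_le_real]; positivity
  have hc' : (0 : ℂ) < ((s / 2 : ℝ) : ℂ) := by
    rw [Complex.zero_lt_real]; positivity
  have hQ : (((s / 2 : ℝ) : ℂ) • (A + Vᴴ * A * V)).PosDef :=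
    (hA.add_posSemidef (hA.posSemidef.conjTranspose_mul_mul_same V)).smul hc'
  have hle := hd.smul hc
  have hm := aux_mono N hNs hNa hUI hP hQ ?_
  · rw [hNs] at hm
    have h3 := hNa A (Vᴴ * A * V)
    have h4 : N (Vᴴ * A * V) = N A := hUI _ _ _ (Unitary.star_mem hV) hV
    have h5 : ‖((s / 2 : ℝ) : ℂ)‖ = s / 2 := by
      rw [Complex.norm_real, Real.norm_of_nonneg (by positivity)]
    rw [h5] at hm
    nlinarith
  · convert hle using 1
    have : (V * P)ᴴ * V + Vᴴ * (V * P) = (2 : ℂ) • P := by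
      rw [Matrix.conjTranspose_mul, hP.isHermitian.eq, mul_assoc, hVV, ← mul_assoc, hVV, mul_one,
        one_mul, two_smul]
    rw [this]
    push_cast
    module

theorem aux_form_pos {n : ℕ} {X : Matrix (Fin n) (Fin n) ℂ} {α : ℝ}
    (h : numRange X ⊆ sector α) (x : Fin n → ℂ) (hx : x ≠ 0) :
    star x ⬝ᵥ X.mulVec x ∈ sector α := by
  have hp : 0 < star x ⬝ᵥ x := Matrix.dotProduct_star_self_pos_iff.2 hx
  obtain ⟨hp1, hp2⟩ := Complex.pos_iff.1 hp
  set r := (star x ⬝ᵥ x).re with hr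
  have hxr : star x ⬝ᵥ x = (r : ℂ) := Complex.ext (by simp [hr]) (by simp [← hp2])
  set c : ℝ := (Real.sqrt r)⁻¹ with hc
  have hc0 : 0 < c := by positivity
  have hcc : c * c * r = 1 := by
    have := Real.mul_self_sqrt hp1.le
    have h0 : 0 < Real.sqrt r := by positivity
    rw [hc]; field_simp; nlinarith
  have hS : star (c : ℂ) = c := Complex.conj_ofReal c
  have hm : star ((c : ℂ) • x) ⬝ᵥ X.mulVec ((c : ℂ) • x) ∈ numRange X := by
    refine ⟨(c : ℂ) • x, ?_, rfl⟩
    rw [star_smul, hS, smul_dotProduct, dotProduct_smul, hxr, smul_eq_mul, smul_eq_mul, ← mul_assoc]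
    exact_mod_cast hcc
  have := h hm
  rw [star_smul, hS, smul_dotProduct, Matrix.mulVec_smul, dotProduct_smul, smul_eq_mul, smul_eq_mul,
    ← mul_assoc] at this
  obtain ⟨a1, a2⟩ := this
  have hre : ∀ w : ℂ, ((c : ℂ) * c * w).re = c * c * w.re := fun w => by
    rw [← Complex.ofReal_mul, Complex.re_ofReal_mul]
  have him : ∀ w : ℂ, ((c : ℂ) * c * w).im = c * c * w.im := fun w => by
    rw [← Complex.ofReal_mul, Complex.im_ofReal_mul]
  have hcp : 0 < c * c := by positivity
  rw [hre] at a1 a2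
  rw [him, abs_mul, abs_of_pos hcp] at a2
  refine ⟨(pos_iff_pos_of_mul_pos a1).1 hcp, ?_⟩
  rw [mul_left_comm] at a2
  exact le_of_mul_le_mul_left a2 hcp

theorem aux_conj {n : ℕ} (X : Matrix (Fin n) (Fin n) ℂ) (x : Fin n → ℂ) :
    star x ⬝ᵥ Xᴴ.mulVec x = star (star x ⬝ᵥ X.mulVec x) := by
  rw [Matrix.star_dotProduct, Matrix.star_mulVec, Matrix.conjTranspose_conjTranspose,
    Matrix.dotProduct_mulVec]

theorem aux_re_form {n : ℕ} (X : Matrix (Fin n) (Fin n) ℂ) (x : Fin n → ℂ) :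
    star x ⬝ᵥ (matRe X).mulVec x = ((star x ⬝ᵥ X.mulVec x).re : ℂ) := by
  rw [matRe, Matrix.smul_mulVec, dotProduct_smul, Matrix.add_mulVec, dotProduct_add, aux_conj]
  apply Complex.ext <;> simp <;> ring

theorem aux_im_form {n : ℕ} (X : Matrix (Fin n) (Fin n) ℂ) (x : Fin n → ℂ) :
    star x ⬝ᵥ (matIm X).mulVec x = ((star x ⬝ᵥ X.mulVec x).im : ℂ) := by
  rw [matIm, Matrix.smul_mulVec, dotProduct_smul, Matrix.sub_mulVec, dotProduct_sub, aux_conj]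
  apply Complex.ext <;> simp <;> ring

theorem aux_re_herm {n : ℕ} (X : Matrix (Fin n) (Fin n) ℂ) : (matRe X).IsHermitian := by
  have h : star (1 / 2 : ℂ) = 1 / 2 := by simp
  rw [Matrix.IsHermitian, matRe, Matrix.conjTranspose_smul, h, Matrix.conjTranspose_add,
    Matrix.conjTranspose_conjTranspose, add_comm]

theorem aux_im_herm {n : ℕ} (X : Matrix (Fin n) (Fin n) ℂ) : (matIm X).IsHermitian := by
  have h : star (1 / (2 * Complex.I) : ℂ) = -(1 / (2 * Complex.I)) := by
    simp
  rw [Matrix.IsHermitian, matIm, Matrix.conjTranspose_smul, h, Matrix.conjTranspose_sub,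
    Matrix.conjTranspose_conjTranspose]
  module

theorem aux_decomp {n : ℕ} (X : Matrix (Fin n) (Fin n) ℂ) :
    matRe X + Complex.I • matIm X = X := by
  have h : Complex.I * (1 / (2 * Complex.I)) = 1 / 2 := by
    field_simp
  rw [matRe, matIm, smul_smul, h]
  module

theorem aux_unit {n : ℕ} {X : Matrix (Fin n) (Fin n) ℂ} {α : ℝ}
    (h : numRange X ⊆ sector α) : IsUnit X := by
  rw [← Matrix.mulVec_injective_iff_isUnit]
  intro x y hxy
  by_contra hne
  have h1 := aux_form_pos h (x - y) (sub_ne_zero.2 hne)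
  have h2 : X.mulVec (x - y) = 0 := by
    rw [Matrix.mulVec_sub]; exact sub_eq_zero.2 hxy
  rw [h2, dotProduct_zero] at h1
  exact lt_irrefl _ h1.1

theorem aux_sector {n : ℕ} (N : Matrix (Fin n) (Fin n) ℂ → ℝ)
    (hNs : ∀ (c : ℂ) (A : Matrix (Fin n) (Fin n) ℂ), N (c • A) = ‖c‖ * N A)
    (hNa : ∀ A B : Matrix (Fin n) (Fin n) ℂ, N (A + B) ≤ N A + N B)
    (hUI : ∀ U V A : Matrix (Fin n) (Fin n) ℂ, U ∈ Matrix.unitaryGroup (Fin n) ℂ →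
      V ∈ Matrix.unitaryGroup (Fin n) ℂ → N (U * A * V) = N A)
    {X : Matrix (Fin n) (Fin n) ℂ} {α : ℝ} (h0 : 0 ≤ α) (h1 : α < Real.pi / 2)
    (h : numRange X ⊆ sector α) : N X ≤ (Real.cos α)⁻¹ * N (matRe X) := by
  have hcos : 0 < Real.cos α := Real.cos_pos_of_mem_Ioo ⟨by linarith [Real.pi_pos], h1⟩
  have ht : 0 ≤ Real.tan α := Real.tan_nonneg_of_nonneg_of_le_pi_div_two h0 h1.le
  have hst : (Real.cos α)⁻¹ ^ 2 = 1 + Real.tan α ^ 2 := by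
    rw [inv_pow, ← Real.inv_one_add_tan_sq hcos.ne', inv_inv]
  have hA : (matRe X).PosDef := by
    refine Matrix.PosDef.of_dotProduct_mulVec_pos (aux_re_herm X) fun x hx => ?_
    rw [aux_re_form, Complex.zero_lt_real]
    exact (aux_form_pos h x hx).1
  have hab : ∀ x, |(star x ⬝ᵥ X.mulVec x).im| ≤ Real.tan α * (star x ⬝ᵥ X.mulVec x).re := by
    intro x
    by_cases hx : x = 0
    · simp [hx]
    · exact (aux_form_pos h x hx).2
  have hT : star ((Real.tan α : ℝ) : ℂ) = (Real.tan α : ℝ) := Complex.conj_ofReal _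
  have hTA : ((Real.tan α : ℂ) • matRe X).IsHermitian := by
    rw [Matrix.IsHermitian, Matrix.conjTranspose_smul, hT, aux_re_herm]
  have hp : ((Real.tan α : ℂ) • matRe X + matIm X).PosSemidef := by
    refine Matrix.PosSemidef.of_dotProduct_mulVec_nonneg (hTA.add (aux_im_herm X)) fun x => ?_
    rw [Matrix.add_mulVec, Matrix.smul_mulVec, dotProduct_add, dotProduct_smul, aux_re_form,
      aux_im_form, smul_eq_mul, ← Complex.ofReal_mul, ← Complex.ofReal_add, Complex.zero_le_real]
    linarith [(abs_le.1 (hab x)).1]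
  have hm : ((Real.tan α : ℂ) • matRe X - matIm X).PosSemidef := by
    refine Matrix.PosSemidef.of_dotProduct_mulVec_nonneg (hTA.sub (aux_im_herm X)) fun x => ?_
    rw [Matrix.sub_mulVec, Matrix.smul_mulVec, dotProduct_sub, dotProduct_smul, aux_re_form,
      aux_im_form, smul_eq_mul, ← Complex.ofReal_mul, ← Complex.ofReal_sub, Complex.zero_le_real]
    linarith [(abs_le.1 (hab x)).2]
  have := aux_sec N hNs hNa hUI hA (aux_im_herm X) ht (inv_pos.2 hcos) hst hp hm
    (by rw [aux_decomp]; exact aux_unit h)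
  rwa [aux_decomp] at this

theorem aux_le {n : ℕ} (N : Matrix (Fin n) (Fin n) ℂ → ℝ)
    (hNs : ∀ (c : ℂ) (A : Matrix (Fin n) (Fin n) ℂ), N (c • A) = ‖c‖ * N A)
    (hNa : ∀ A B : Matrix (Fin n) (Fin n) ℂ, N (A + B) ≤ N A + N B)
    (hUI : ∀ U V A : Matrix (Fin n) (Fin n) ℂ, U ∈ Matrix.unitaryGroup (Fin n) ℂ →
      V ∈ Matrix.unitaryGroup (Fin n) ℂ → N (U * A * V) = N A)
    {X : Matrix (Fin n) (Fin n) ℂ} (hX : IsUnit X) (θ : ℝ) :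
    N (matRe (Complex.exp (θ * Complex.I) • X)) ≤ N X := by
  have h2 : ‖(1 / 2 : ℂ)‖ = 1 / 2 := by norm_num
  have he : ‖Complex.exp (θ * Complex.I)‖ = 1 := Complex.norm_exp_ofReal_mul_I θ
  rw [matRe, hNs, h2]
  have h3 := hNa (Complex.exp (θ * Complex.I) • X) (Complex.exp (θ * Complex.I) • X)ᴴ
  rw [Matrix.conjTranspose_smul, hNs, hNs, norm_star, he, aux_star N hUI hX] at h3
  rw [Matrix.conjTranspose_smul]
  linarith

theorem aux_class {n : ℕ} (N : Matrix (Fin n) (Fin n) ℂ → ℝ)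
    (hNs : ∀ (c : ℂ) (A : Matrix (Fin n) (Fin n) ℂ), N (c • A) = ‖c‖ * N A)
    (hNa : ∀ A B : Matrix (Fin n) (Fin n) ℂ, N (A + B) ≤ N A + N B)
    (hUI : ∀ U V A : Matrix (Fin n) (Fin n) ℂ, U ∈ Matrix.unitaryGroup (Fin n) ℂ →
      V ∈ Matrix.unitaryGroup (Fin n) ℂ → N (U * A * V) = N A)
    {X : Matrix (Fin n) (Fin n) ℂ} {α : ℝ} (h0 : 0 ≤ α) (h1 : α < Real.pi / 2)
    (h : X ∈ sectClass n α) : IsUnit X ∧ N X ≤ (Real.cos α)⁻¹ * gnr N X := by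
  obtain ⟨z, hz, hW⟩ := h
  have hz0 : z ≠ 0 := by rintro rfl; simp at hz
  have hXu : IsUnit X := by
    have h2 := aux_unit hW
    rw [Matrix.isUnit_iff_isUnit_det, Matrix.det_smul] at h2
    rw [Matrix.isUnit_iff_isUnit_det]
    exact isUnit_of_mul_isUnit_right h2
  refine ⟨hXu, ?_⟩
  have hcos : 0 < Real.cos α := Real.cos_pos_of_mem_Ioo ⟨by linarith [Real.pi_pos], h1⟩
  have h3 := aux_sector N hNs hNa hUI h0 h1 hW
  rw [hNs, hz, one_mul] at h3
  refine h3.trans (mul_le_mul_of_nonneg_left ?_ (inv_pos.2 hcos).le)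
  have hze : Complex.exp ((Complex.arg z : ℝ) * Complex.I) = z := by
    have := Complex.norm_mul_exp_arg_mul_I z
    rwa [hz, Complex.ofReal_one, one_mul] at this
  have hb : BddAbove (Set.range fun θ : ℝ => N (matRe (Complex.exp (θ * Complex.I) • X))) := by
    refine ⟨N X, ?_⟩
    rintro _ ⟨θ, rfl⟩
    exact aux_le N hNs hNa hUI hXu θ
  have h4 := le_ciSup hb (Complex.arg z)
  simp only [hze] at h4
  exact h4

end Helpers

theorem stmt_3 {n : ℕ} (N : Matrix (Fin n) (Fin n) ℂ → ℝ)
    (hN0 : ∀ A : Matrix (Fin n) (Fin n) ℂ, N A = 0 ↔ A = 0)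
    (hNs : ∀ (c : ℂ) (A : Matrix (Fin n) (Fin n) ℂ), N (c • A) = ‖c‖ * N A)
    (hNa : ∀ A B : Matrix (Fin n) (Fin n) ℂ, N (A + B) ≤ N A + N B)
    (hUI : ∀ U V A : Matrix (Fin n) (Fin n) ℂ, U ∈ Matrix.unitaryGroup (Fin n) ℂ →
      V ∈ Matrix.unitaryGroup (Fin n) ℂ → N (U * A * V) = N A)
    (hSM : ∀ A B : Matrix (Fin n) (Fin n) ℂ, N (A * B) ≤ N A * N B)
    {α₁ α₂ : ℝ} (hα₁0 : 0 ≤ α₁) (hα₁1 : α₁ < Real.pi / 2)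
    (hα₂0 : 0 ≤ α₂) (hα₂1 : α₂ < Real.pi / 2)
    (X Y : Matrix (Fin n) (Fin n) ℂ)
    (hX : X ∈ sectClass n α₁) (hY : Y ∈ sectClass n α₂) :
    gnr N (X * Y) ≤ (Real.cos α₁)⁻¹ * (Real.cos α₂)⁻¹ * gnr N X * gnr N Y := by
  have hpos : ∀ A, 0 ≤ N A := by
    intro A
    have h1 := hNa A (-A)
    have h2 : N (-A) = N A := by simpa using hNs (-1) A
    rw [add_neg_cancel, (hN0 0).2 rfl, h2] at h1
    linarith
  obtain ⟨uX, bX⟩ := aux_class N hNs hNa hUI hα₁0 hα₁1 hX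
  obtain ⟨uY, bY⟩ := aux_class N hNs hNa hUI hα₂0 hα₂1 hY
  have h1 : gnr N (X * Y) ≤ N (X * Y) :=
    ciSup_le fun θ => aux_le N hNs hNa hUI (uX.mul uY) θ
  calc gnr N (X * Y) ≤ N X * N Y := h1.trans (hSM X Y)
    _ ≤ ((Real.cos α₁)⁻¹ * gnr N X) * ((Real.cos α₂)⁻¹ * gnr N Y) :=
      mul_le_mul bX bY (hpos _) ((hpos _).trans bX)
    _ = _ := by ring
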